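/- Let m be an integer, V a finite-dimensional ℚ-vector space, and (H_p)_{p∈ℤ} a family of ℂ-subspaces of V_ℂ such that V_ℂ is the internal direct sum of the H_p and c(H_p) = H_{m−p} for all p (a Hodge structure of weight m on V). Let K be a number field and σ : K → K a ℚ-algebra automorphism such that ρ(σ(a)) = conj(ρ(a)) for every ring embedding ρ : K → ℂ; suppose K acts on V by ℚ-linear endomorphisms with each H_p stable under a ⊗ 1 for all a ∈ K. If there exists a polarization B of this Hodge structure, then there exists a polarization B₂ that moreover satisfies B₂(a•x, y) = B₂(x, σ(a)•y) for all a ∈ K and x, y ∈ V. -/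

import Mathlib

open TensorProduct

/-- Complex conjugation `c = id_V ⊗ conj` on `V_ℂ = ℂ ⊗[ℚ] V`. -/
noncomputable def conjC (V : Type*) [AddCommGroup V] [Module ℚ V] :
    (ℂ ⊗[ℚ] V) →ₗ[ℚ] (ℂ ⊗[ℚ] V) :=
  LinearMap.rTensor V ((Complex.conjAe.toLinearMap).restrictScalars ℚ)

/-- The action of `a ∈ K` on `ℂ ⊗[ℚ] V`, i.e. `a ⊗ 1`. -/
noncomputable def actionC (K V : Type*) [Field K] [Algebra ℚ K] [AddCommGroup V]
    [Module ℚ V] [Module K V] [IsScalarTower ℚ K V] (a : K) :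
    (ℂ ⊗[ℚ] V) →ₗ[ℂ] (ℂ ⊗[ℚ] V) :=
  LinearMap.baseChange ℂ ((LinearMap.lsmul K V a).restrictScalars ℚ)

/-- A polarization of the weight-`m` Hodge structure `(H p)` on `V`. -/
def IsPolarization (V : Type*) [AddCommGroup V] [Module ℚ V] (m : ℤ)
    (H : ℤ → Submodule ℂ (ℂ ⊗[ℚ] V)) (B : LinearMap.BilinForm ℚ V) : Prop :=
  (∀ x y : V, B y x = (-1 : ℚ) ^ m * B x y) ∧
  (∀ p p' : ℤ, p' ≠ m - p → ∀ x ∈ H p, ∀ y ∈ H p', B.baseChange ℂ x y = 0) ∧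
  (∀ p : ℤ, ∀ x ∈ H p, x ≠ 0 → ∃ r : ℝ, 0 < r ∧
    Complex.I ^ (2 * p - m) * (-1 : ℂ) ^ (m * (m - 1) / 2) *
      (B.baseChange ℂ x (conjC V x)) = (r : ℂ))

open Module

section Conjugation

variable {V : Type*} [AddCommGroup V] [Module ℚ V]

theorem conjC_tmul (z : ℂ) (v : V) : conjC V (z ⊗ₜ v) = (starRingEnd ℂ z) ⊗ₜ v := rfl

theorem conjC_smul (z : ℂ) (x : ℂ ⊗[ℚ] V) :
    conjC V (z • x) = (starRingEnd ℂ z) • conjC V x := by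
  induction x with
  | zero => simp
  | tmul w v => simp [smul_tmul', conjC_tmul]
  | add x y hx hy => simp only [smul_add, map_add, hx, hy]

end Conjugation

section Action

variable {K V : Type*} [Field K] [Algebra ℚ K] [AddCommGroup V] [Module ℚ V] [Module K V]
  [IsScalarTower ℚ K V]

theorem actionC_tmul (a : K) (z : ℂ) (v : V) : actionC K V a (z ⊗ₜ v) = z ⊗ₜ (a • v) := rfl

theorem conjC_actionC (a : K) (x : ℂ ⊗[ℚ] V) :
    conjC V (actionC K V a x) = actionC K V a (conjC V x) := by
  induction x with
  | zero => simp
  | tmul w v => simp [conjC_tmul, actionC_tmul]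
  | add x y hx hy => simp only [map_add, hx, hy]

theorem sum_smul_actionC {ι : Type*} (s : Finset ι) (q : ι → ℚ) (a : ι → K) (x : ℂ ⊗[ℚ] V) :
    ∑ i ∈ s, ((q i : ℂ)) • actionC K V (a i) x = actionC K V (∑ i ∈ s, q i • a i) x := by
  induction x with
  | zero => simp
  | tmul w v =>
    simp only [actionC_tmul, Finset.sum_smul, tmul_sum, smul_assoc, tmul_smul]
    refine Finset.sum_congr rfl fun i _ => ?_
    rw [smul_tmul', smul_tmul', ← Rat.cast_smul_eq_qsmul ℂ]
  | add x y hx hy => simp only [map_add, smul_add, Finset.sum_add_distrib, hx, hy]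

theorem actionC_one (x : ℂ ⊗[ℚ] V) : actionC K V 1 x = x := by
  induction x with
  | zero => simp
  | tmul w v => simp [actionC_tmul]
  | add x y hx hy => simp only [map_add, hx, hy]

/-- The bilinear form `∑ i j, t i j * B (b i • x) (b j • y)`. -/
noncomputable def twistedForm {ι : Type*} [Fintype ι] (B : LinearMap.BilinForm ℚ V)
    (t : ι → ι → ℚ) (b : ι → K) : LinearMap.BilinForm ℚ V :=
  ∑ i, ∑ j, t i j • B.compl₁₂ ((LinearMap.lsmul K V (b i)).restrictScalars ℚ)
    ((LinearMap.lsmul K V (b j)).restrictScalars ℚ)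

variable {ι : Type*} [Fintype ι] (B : LinearMap.BilinForm ℚ V) (t : ι → ι → ℚ) (b : ι → K)

theorem twistedForm_apply (x y : V) :
    twistedForm B t b x y = ∑ i, ∑ j, t i j * B (b i • x) (b j • y) := by
  simp [twistedForm, LinearMap.sum_apply]

theorem twistedForm_baseChange (x y : ℂ ⊗[ℚ] V) :
    (twistedForm B t b).baseChange ℂ x y =
      ∑ i, ∑ j, (t i j : ℂ) * B.baseChange ℂ (actionC K V (b i) x) (actionC K V (b j) y) := by
  induction x with
  | zero => simp
  | add x x' hx hx' =>
    simp only [map_add, LinearMap.add_apply, hx, hx', mul_add, Finset.sum_add_distrib]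
  | tmul z v =>
    induction y with
    | zero => simp
    | add y y' hy hy' => simp only [map_add, hy, hy', mul_add, Finset.sum_add_distrib]
    | tmul w u =>
      simp only [actionC_tmul, LinearMap.BilinForm.baseChange_tmul, twistedForm_apply,
        Finset.sum_smul, mul_smul]
      refine Finset.sum_congr rfl fun i _ => Finset.sum_congr rfl fun j _ => ?_
      simp only [← Rat.cast_smul_eq_qsmul ℂ, smul_eq_mul]

end Action

section Trace

variable {K : Type*} [Field K] [NumberField K] {ι : Type*} [Fintype ι] [DecidableEq ι]

theorem sum_trace_mul_smul_traceDual (b : Basis ι ℚ K) (z : K) :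
    ∑ i, Algebra.trace ℚ K (z * b i) • b.traceDual i = z := by
  conv_rhs => rw [← b.traceDual.sum_repr z]
  simp only [Basis.traceDual_repr_apply, Algebra.traceForm_apply]

theorem sum_trace_mul_traceDual_smul (b : Basis ι ℚ K) (z : K) :
    ∑ i, Algebra.trace ℚ K (z * b.traceDual i) • b i = z := by
  simpa using sum_trace_mul_smul_traceDual b.traceDual z

end Trace

section Involution

variable {K : Type*} [Field K] [NumberField K] {σ : K ≃ₐ[ℚ] K}

theorem involutive_of_forall_embedding_conj
    (hσ : ∀ (ρ : K →+* ℂ) (a : K), ρ (σ a) = (starRingEnd ℂ) (ρ a)) (a : K) :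
    σ (σ a) = a := by
  obtain ⟨ρ⟩ : Nonempty (K →+* ℂ) := inferInstance
  exact ρ.injective (by simp [hσ])

theorem trace_mul_involution_comm
    (hσ : ∀ (ρ : K →+* ℂ) (a : K), ρ (σ a) = (starRingEnd ℂ) (ρ a)) (a a' : K) :
    Algebra.trace ℚ K (a * σ a') = Algebra.trace ℚ K (a' * σ a) := by
  rw [← Algebra.trace_eq_of_algEquiv σ, map_mul, involutive_of_forall_embedding_conj hσ, mul_comm]

end Involution

section Hermitian

variable {K V : Type*} [Field K] [NumberField K] [AddCommGroup V] [Module ℚ V] [Module K V]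
  [IsScalarTower ℚ K V] {ι : Type*} [Fintype ι]

/-- For `d` the trace-dual basis of `b`, the projection of `ℂ ⊗[ℚ] V` onto the subspace on which
`K` acts through the embedding `ρ`. -/
noncomputable def embeddingProj (d b : ι → K) (ρ : K →ₐ[ℚ] ℂ) (x : ℂ ⊗[ℚ] V) : ℂ ⊗[ℚ] V :=
  ∑ i, ρ (d i) • actionC K V (b i) x

theorem sum_embeddingProj [DecidableEq ι] (b : Basis ι ℚ K) (x : ℂ ⊗[ℚ] V) :
    ∑ ρ : K →ₐ[ℚ] ℂ, embeddingProj b.traceDual b ρ x = x := by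
  simp only [embeddingProj]
  rw [Finset.sum_comm]
  simp only [← Finset.sum_smul, ← trace_eq_sum_embeddings ℂ (K := ℚ) (L := K)]
  have h := sum_trace_mul_traceDual_smul b 1
  simp only [one_mul] at h
  simpa [h, actionC_one] using sum_smul_actionC Finset.univ
    (fun i => Algebra.trace ℚ K (b.traceDual i)) b x

theorem twistedForm_baseChange_conjC {σ : K ≃ₐ[ℚ] K}
    (hσ : ∀ (ρ : K →+* ℂ) (a : K), ρ (σ a) = (starRingEnd ℂ) (ρ a))
    (B : LinearMap.BilinForm ℚ V) (d b : ι → K) (x : ℂ ⊗[ℚ] V) :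
    (twistedForm B (fun i j => Algebra.trace ℚ K (d i * σ (d j))) b).baseChange ℂ x (conjC V x) =
      ∑ ρ : K →ₐ[ℚ] ℂ,
        B.baseChange ℂ (embeddingProj d b ρ x) (conjC V (embeddingProj d b ρ x)) := by
  have htrace (i j : ι) : ((Algebra.trace ℚ K (d i * σ (d j)) : ℚ) : ℂ) =
      ∑ ρ : K →ₐ[ℚ] ℂ, ρ (d i) * (starRingEnd ℂ) (ρ (d j)) := by
    have h := trace_eq_sum_embeddings ℂ (K := ℚ) (x := d i * σ (d j))
    rw [eq_ratCast] at h
    rw [h]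
    exact Finset.sum_congr rfl fun ρ _ => by rw [map_mul]; congr 1; exact hσ ρ.toRingHom (d j)
  rw [twistedForm_baseChange]
  simp only [htrace, embeddingProj, map_sum, LinearMap.sum_apply, conjC_smul, conjC_actionC,
    map_smul, LinearMap.smul_apply, smul_eq_mul, Finset.sum_mul,
    Finset.mul_sum]
  simp only [Finset.sum_comm (s := (Finset.univ : Finset (K →ₐ[ℚ] ℂ)))]
  rw [Finset.sum_comm]
  exact Finset.sum_congr rfl fun j _ => Finset.sum_congr rfl fun i _ =>
    Finset.sum_congr rfl fun ρ _ => by ring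

theorem twistedForm_trace_apply [DecidableEq ι] {σ : K ≃ₐ[ℚ] K}
    (hσ : ∀ (ρ : K →+* ℂ) (a : K), ρ (σ a) = (starRingEnd ℂ) (ρ a))
    (B : LinearMap.BilinForm ℚ V) (b : Basis ι ℚ K) (x y : V) :
    twistedForm B (fun i j => Algebra.trace ℚ K (b.traceDual i * σ (b.traceDual j))) b x y =
      ∑ i, B (b i • x) (σ (b.traceDual i) • y) := by
  rw [twistedForm_apply]
  refine Finset.sum_congr rfl fun i _ => ?_
  simp only [trace_mul_involution_comm hσ (b.traceDual i)]
  conv_rhs => rw [← sum_trace_mul_traceDual_smul b (σ (b.traceDual i))]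
  simp only [Finset.sum_smul, map_sum, smul_assoc, map_smul, smul_eq_mul, mul_comm]

theorem twistedForm_smul_left [DecidableEq ι] {σ : K ≃ₐ[ℚ] K}
    (hσ : ∀ (ρ : K →+* ℂ) (a : K), ρ (σ a) = (starRingEnd ℂ) (ρ a))
    (B : LinearMap.BilinForm ℚ V) (b : Basis ι ℚ K) (a : K) (x y : V) :
    twistedForm B (fun i j => Algebra.trace ℚ K (b.traceDual i * σ (b.traceDual j))) b (a • x) y =
      twistedForm B (fun i j => Algebra.trace ℚ K (b.traceDual i * σ (b.traceDual j))) b x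
        (σ a • y) := by
  rw [twistedForm_trace_apply hσ, twistedForm_trace_apply hσ]
  have hleft (i : ι) : b i • a • x =
      ∑ k, Algebra.trace ℚ K (b i * a * b.traceDual k) • b k • x := by
    rw [smul_smul]
    conv_lhs => rw [← sum_trace_mul_traceDual_smul b (b i * a)]
    simp only [Finset.sum_smul, smul_assoc]
  have hright (k : ι) : σ (b.traceDual k) • σ a • y =
      ∑ i, Algebra.trace ℚ K (b i * a * b.traceDual k) • σ (b.traceDual i) • y := by
    rw [smul_smul, ← map_mul]
    conv_lhs => rw [← sum_trace_mul_smul_traceDual b (b.traceDual k * a)]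
    rw [map_sum, Finset.sum_smul]
    refine Finset.sum_congr rfl fun i _ => ?_
    rw [map_rat_smul, smul_assoc, mul_rotate (b i), mul_comm a]
  simp only [hleft, hright, map_sum, LinearMap.sum_apply, map_smul, LinearMap.smul_apply]
  exact Finset.sum_comm

end Hermitian

/-- If a weight-`m` Hodge structure on `V` with an action of a totally real
or CM field `K` (each `H p` being `K`-stable) admits a polarization, then it admits a
polarization `B₂` with `B₂ (a • x) y = B₂ x (σ a • y)` for all `a ∈ K`. -/
theorem exists_K_compatible_polarization
    (K : Type*) [Field K] [NumberField K]
    (σ : K ≃ₐ[ℚ] K)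
    (hσ : ∀ (ρ : K →+* ℂ) (a : K), ρ (σ a) = (starRingEnd ℂ) (ρ a))
    (V : Type*) [AddCommGroup V] [Module ℚ V] [Module K V] [IsScalarTower ℚ K V]
    [FiniteDimensional ℚ V]
    (m : ℤ) (H : ℤ → Submodule ℂ (ℂ ⊗[ℚ] V))
    (hinternal : DirectSum.IsInternal H)
    (hconj : ∀ p : ℤ, Submodule.map (conjC V) ((H p).restrictScalars ℚ) =
      (H (m - p)).restrictScalars ℚ)
    (hstable : ∀ (p : ℤ) (a : K), ∀ w ∈ H p, actionC K V a w ∈ H p)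
    (hpol : ∃ B : LinearMap.BilinForm ℚ V, IsPolarization V m H B) :
    ∃ B₂ : LinearMap.BilinForm ℚ V, IsPolarization V m H B₂ ∧
      ∀ (a : K) (x y : V), B₂ (a • x) y = B₂ x (σ a • y) := by
  classical
  obtain ⟨B, hsymm, horth, hpos⟩ := hpol
  let b := finBasis ℚ K
  let t := fun i j => Algebra.trace ℚ K (b.traceDual i * σ (b.traceDual j))
  have ht (i j) : t i j = t j i := trace_mul_involution_comm hσ _ _
  refine ⟨twistedForm B t b, ⟨fun x y => ?_, fun p p' hp x hx y hy => ?_, fun p x hx hx0 => ?_⟩,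
    fun a x y => ?_⟩
  · simp only [twistedForm_apply, Finset.mul_sum]
    rw [Finset.sum_comm]
    refine Finset.sum_congr rfl fun i _ => Finset.sum_congr rfl fun j _ => ?_
    rw [ht, hsymm (b i • x)]
    ring
  · rw [twistedForm_baseChange]
    exact Finset.sum_eq_zero fun i _ => Finset.sum_eq_zero fun j _ => by
      rw [horth p p' hp _ (hstable _ _ _ hx) _ (hstable _ _ _ hy), mul_zero]
  · have hmem (ρ : K →ₐ[ℚ] ℂ) : embeddingProj b.traceDual b ρ x ∈ H p :=
      Submodule.sum_mem _ fun i _ => Submodule.smul_mem _ _ (hstable _ _ _ hx)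
    obtain ⟨ρ₀, hρ₀⟩ : ∃ ρ : K →ₐ[ℚ] ℂ, embeddingProj b.traceDual b ρ x ≠ 0 := by
      by_contra! h
      exact hx0 (by rw [← sum_embeddingProj b x]; simp [h])
    have hterm (ρ : K →ₐ[ℚ] ℂ) : ∃ r : ℝ, 0 ≤ r ∧
        (embeddingProj b.traceDual b ρ x ≠ 0 → 0 < r) ∧
        Complex.I ^ (2 * p - m) * (-1 : ℂ) ^ (m * (m - 1) / 2) *
          B.baseChange ℂ (embeddingProj b.traceDual b ρ x)
            (conjC V (embeddingProj b.traceDual b ρ x)) = (r : ℂ) := by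
      by_cases h : embeddingProj b.traceDual b ρ x = 0
      · exact ⟨0, le_rfl, fun h' => absurd h h', by simp [h]⟩
      · obtain ⟨r, hr, hr'⟩ := hpos p _ (hmem ρ) h
        exact ⟨r, hr.le, fun _ => hr, hr'⟩
    choose r hr0 hr hr' using hterm
    refine ⟨∑ ρ, r ρ, Finset.sum_pos' (fun ρ _ => hr0 ρ) ⟨ρ₀, Finset.mem_univ _, hr ρ₀ hρ₀⟩, ?_⟩
    rw [twistedForm_baseChange_conjC hσ, Finset.mul_sum, Complex.ofReal_sum]
    exact Finset.sum_congr rfl fun ρ _ => hr' ρ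
  · exact twistedForm_smul_left hσ B b a x y
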